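/- arXiv:1104.5660 — 5 statements merged into one kernel-verified Lean document; each statement's English description precedes it below -/
import Mathlib

section
/- Let n ≥ 1 and let S be a finite subset of ZMod n that is not periodic (there is no r ≠ 0 with S + r = S). Then at most two robots have the same view: for every p ∈ S, the set {q ∈ S : S − q = S − p or S − p = q − S} has at most two elements. -/
/-- In a finite set without nontrivial translational symmetry, the translate `S - p` determines
`p`. -/
theorem Finset.eq_of_image_sub_right_eq {G : Type*} [AddCommGroup G] [DecidableEq G]
    {S : Finset G} (hper : ¬ ∃ r : G, r ≠ 0 ∧ S.image (fun x => x + r) = S) {p q : G}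
    (h : S.image (fun x => x - q) = S.image (fun x => x - p)) : q = p := by
  by_contra hne
  refine hper ⟨p - q, sub_ne_zero.mpr (Ne.symm hne), ?_⟩
  have h' := congrArg (Finset.image (fun x => x + p)) h
  simp only [Finset.image_image, Function.comp_def, sub_add_cancel, Finset.image_id'] at h'
  simpa only [add_sub_assoc', add_sub_right_comm] using h'

/-- In a finite set without nontrivial translational symmetry, the reflection `p - S` determines
`p`. -/
theorem Finset.eq_of_image_sub_left_eq {G : Type*} [AddCommGroup G] [DecidableEq G]
    {S : Finset G} (hper : ¬ ∃ r : G, r ≠ 0 ∧ S.image (fun x => x + r) = S) {p q : G}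
    (h : S.image (fun x => q - x) = S.image (fun x => p - x)) : q = p := by
  refine Finset.eq_of_image_sub_right_eq hper ?_
  simpa only [Finset.image_image, Function.comp_def, neg_sub] using
    congrArg (Finset.image Neg.neg) h

/-- In a non-periodic configuration, at most two robots share the same view. -/
theorem at_most_two_same_view (n : ℕ) (hn : 1 ≤ n) (S : Finset (ZMod n))
    (hper : ¬ ∃ r : ZMod n, r ≠ 0 ∧ S.image (fun x => x + r) = S) :
    ∀ p ∈ S,
      (S.filter (fun q =>
        S.image (fun x => x - q) = S.image (fun x => x - p) ∨
        S.image (fun x => x - p) = S.image (fun x => q - x))).card ≤ 2 := by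
  intro p _
  rw [Finset.filter_or]
  refine (Finset.card_union_le _ _).trans (Nat.add_le_add (b := 1) (d := 1) ?_ ?_) <;>
    refine Finset.card_le_one.mpr fun a ha b hb => ?_
  · exact (Finset.eq_of_image_sub_right_eq hper (Finset.mem_filter.mp ha).2).trans
      (Finset.eq_of_image_sub_right_eq hper (Finset.mem_filter.mp hb).2).symm
  · exact Finset.eq_of_image_sub_left_eq hper
      ((Finset.mem_filter.mp ha).2.symm.trans (Finset.mem_filter.mp hb).2)
end

section
/- Let n ≥ 1 and let S be a finite subset of ZMod n that is not periodic (there is no r ≠ 0 with S + r = S) and is symmetric with axis c (i.e., c − S = S). Then for all p, q ∈ S, the robots at p and q have the same view (S − q = S − p or S − p = q − S) if and only if q = p or q = c − p; that is, the robots sharing a view are exactly the pairs exchanged by the reflection x ↦ c − x. -/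
/-- In a symmetric non-periodic configuration with axis `c`, two robots have the same
view iff they are exchanged by the reflection `x ↦ c - x`. -/
theorem same_view_iff_reflected (n : ℕ) (hn : 1 ≤ n) (S : Finset (ZMod n)) (c : ZMod n)
    (hper : ¬ ∃ r : ZMod n, r ≠ 0 ∧ S.image (fun x => x + r) = S)
    (hsym : S.image (fun x => c - x) = S) :
    ∀ p ∈ S, ∀ q ∈ S,
      (S.image (fun x => x - q) = S.image (fun x => x - p) ∨
       S.image (fun x => x - p) = S.image (fun x => q - x)) ↔ (q = p ∨ q = c - p) := by
  have rigid : ∀ r : ZMod n, S.image (fun x => x + r) = S → r = 0 := fun r hr => by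
    by_contra h0
    exact hper ⟨r, h0, hr⟩
  intro p _ q _
  constructor
  · rintro (h | h)
    · left
      have h' := congrArg (Finset.image (fun x => x + p)) h
      simp only [Finset.image_image, Function.comp_def, sub_add_cancel, Finset.image_id'] at h'
      have hr := rigid (p - q) (by
        convert h' using 3
        ring)
      exact (sub_eq_zero.mp hr).symm
    · right
      have h' := congrArg (Finset.image (fun x => c - p - x)) h
      simp only [Finset.image_image, Function.comp_def, sub_sub_sub_cancel_right, hsym] at h'
      have hr := rigid (c - p - q) (by
        refine Eq.trans (Finset.image_congr fun x _ => ?_) h'.symm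
        ring)
      exact (sub_eq_zero.mp hr).symm
  · rintro (rfl | rfl)
    · exact Or.inl rfl
    · right
      conv_lhs => rw [← hsym]
      simp only [Finset.image_image, Function.comp_def, sub_right_comm]
end

section
/- Let n ≥ 1 and let S be a finite subset of ZMod n of odd cardinality such that c − S = S for some c ∈ ZMod n. Then there is exactly one robot on the axis of symmetry: there exists a unique x ∈ S with x + x = c. -/
/-- The points of a finite set not fixed by an involution cancel in pairs. -/
theorem Finset.even_card_filter_ne_of_involution {α : Type*} [DecidableEq α] (S : Finset α)
    (f : α → α) (hmem : ∀ x ∈ S, f x ∈ S) (hinv : ∀ x ∈ S, f (f x) = x) :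
    Even (S.filter (fun x => f x ≠ x)).card := by
  have key : ∑ _x ∈ S.filter (fun x => f x ≠ x), (1 : ZMod 2) = 0 := by
    refine Finset.sum_involution (fun x _ => f x) (fun _ _ => by decide) ?_ ?_ ?_
    · intro x hx _
      exact (Finset.mem_filter.1 hx).2
    · intro x hx
      obtain ⟨hx, hne⟩ := Finset.mem_filter.1 hx
      refine Finset.mem_filter.2 ⟨hmem x hx, ?_⟩
      rw [hinv x hx]
      exact hne.symm
    · intro x hx
      exact hinv x (Finset.mem_filter.1 hx).1
  rw [← ZMod.natCast_eq_zero_iff_even]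
  simpa using key

/-- `ZMod n` has at most one nonzero element of order two. -/
theorem ZMod.eq_of_add_self_eq_zero {n : ℕ} [NeZero n] {a b : ZMod n} (ha : a + a = 0)
    (hb : b + b = 0) (ha0 : a ≠ 0) (hb0 : b ≠ 0) : a = b := by
  have two_mul_val : ∀ d : ZMod n, d + d = 0 → d ≠ 0 → 2 * d.val = n := by
    intro d hd hd0
    have hdvd : n ∣ d.val + d.val := by
      rw [← ZMod.natCast_eq_zero_iff]
      simpa using hd
    have hlt := ZMod.val_lt d
    have hpos : 0 < d.val := Nat.pos_of_ne_zero (by simpa using hd0)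
    obtain ⟨k, hk⟩ := hdvd
    have hk2 : k < 2 := by
      by_contra! hk2
      nlinarith
    interval_cases k <;> omega
  apply ZMod.val_injective n
  have h₁ := two_mul_val a ha ha0
  have h₂ := two_mul_val b hb hb0
  omega

/-- The equation `x + x = c` has at most two solutions in `ZMod n`. -/
theorem ZMod.card_le_two_of_add_self_eq {n : ℕ} [NeZero n] (c : ZMod n) (F : Finset (ZMod n))
    (hF : ∀ x ∈ F, x + x = c) : F.card ≤ 2 := by
  by_contra! h
  obtain ⟨x, hx, y, hy, z, hz, hxy, hxz, hyz⟩ := Finset.two_lt_card.1 h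
  apply hyz
  have h₁ : y - x + (y - x) = 0 := by linear_combination hF y hy - hF x hx
  have h₂ : z - x + (z - x) = 0 := by linear_combination hF z hz - hF x hx
  exact sub_left_injective
    (ZMod.eq_of_add_self_eq_zero h₁ h₂ (sub_ne_zero.2 hxy.symm) (sub_ne_zero.2 hxz.symm))

/-- A symmetric configuration with an odd number of robots has exactly one robot on
the axis of symmetry. -/
theorem exists_unique_robot_on_axis (n : ℕ) (hn : 1 ≤ n) (S : Finset (ZMod n))
    (hcard : Odd S.card) (c : ZMod n) (h : S.image (fun x => c - x) = S) :
    ∃! x, x ∈ S ∧ x + x = c := by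
  have : NeZero n := ⟨by omega⟩
  have heven := S.even_card_filter_ne_of_involution (fun x => c - x)
    (fun x hx => by rw [← h]; exact Finset.mem_image_of_mem _ hx)
    (fun x _ => sub_sub_cancel c x)
  have hsum := S.card_filter_add_card_filter_not (fun x => c - x = x)
  have hle := ZMod.card_le_two_of_add_self_eq c (S.filter (fun x => c - x = x))
    (fun x hx => (sub_eq_iff_eq_add.1 (Finset.mem_filter.1 hx).2).symm)
  have hone : (S.filter (fun x => c - x = x)).card = 1 := by
    rw [Nat.odd_iff] at hcard
    rw [Nat.even_iff] at heven
    simp only [ne_eq] at heven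
    omega
  obtain ⟨x, hx⟩ := Finset.card_eq_one.1 hone
  have hiff : ∀ y, y ∈ S ∧ y + y = c ↔ y = x := by
    intro y
    rw [← Finset.mem_singleton (a := x), ← hx, Finset.mem_filter, sub_eq_iff_eq_add, eq_comm (a := c)]
  exact ⟨x, (hiff x).2 rfl, fun y hy => (hiff y).1 hy⟩
end

section
/- Let n, d, k be natural numbers with d ≥ 2, k odd, k ≥ 3, and n ≥ k·d. Let a ∈ ZMod n, let S = {a + i·d : 0 ≤ i < k}, and let m = a + ((k−1)/2)·d be the middle robot. Let S' = (S \ {m − d, m + d}) ∪ {m − (d−1), m + (d−1)} be the configuration obtained when the two robots adjacent to the middle robot each move one node toward it. Then: (i) the inter-distance of S' (the minimum circular distance between distinct elements of S') equals d − 1; and (ii) {x ∈ S' : x + (d−1) ∈ S'} = {m − (d−1), m}; consequently S' contains exactly one maximal (d−1).block, namely {m − (d−1), m, m + (d−1)}, of size 3. -/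
/-- Integer offsets, relative to the middle robot, of the configuration obtained from a
`d`.block of size `2 * h + 1` when the two neighbours of the middle robot move toward it. -/
def IsMovedOffset (d h p : ℤ) : Prop :=
  p = 0 ∨ p = d - 1 ∨ p = -(d - 1) ∨ ∃ j : ℤ, 2 ≤ |j| ∧ |j| ≤ h ∧ p = j * d

lemma intCast_zmod_eq_of_abs_sub_lt {n : ℕ} {a b : ℤ} (h : (a : ZMod n) = b)
    (hlt : |a - b| < n) : a = b := by
  have hdvd : (n : ℤ) ∣ a - b := by
    rw [← CharP.intCast_eq_zero_iff (ZMod n) n, Int.cast_sub, h, sub_self]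
  have := Int.eq_zero_of_abs_lt_dvd hdvd hlt
  omega

lemma IsMovedOffset.abs_le {d h p : ℤ} (hd : 2 ≤ d) (hh : 1 ≤ h) (hp : IsMovedOffset d h p) :
    |p| ≤ h * d := by
  rcases hp with rfl | rfl | rfl | ⟨j, -, hj, rfl⟩
  · rw [abs_zero]; positivity
  · rw [abs_of_nonneg (by omega)]; nlinarith
  · rw [abs_neg, abs_of_nonneg (by omega)]; nlinarith
  · rw [abs_mul, abs_of_nonneg (by omega : 0 ≤ d)]; gcongr

/-- Two offsets at distance at most `d - 1` are consecutive among the three central ones. -/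
lemma IsMovedOffset.eq_of_sub_le {d h p q : ℤ} (hd : 2 ≤ d)
    (hp : IsMovedOffset d h p) (hq : IsMovedOffset d h q) (hpos : 0 < q - p)
    (hle : q - p ≤ d - 1) : q - p = d - 1 ∧ (p = -(d - 1) ∨ p = 0) := by
  have far : ∀ j : ℤ, 2 ≤ |j| → j * d ≤ -(2 * d) ∨ 2 * d ≤ j * d := by
    intro j hj
    rcases le_abs.1 hj with hj | hj
    · right; gcongr
    · left; nlinarith
  rcases hp with rfl | rfl | rfl | ⟨i, hi, -, rfl⟩ <;>
    rcases hq with rfl | rfl | rfl | ⟨j, hj, -, rfl⟩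
  case inr.inr.inr.inr.inr.inr =>
    have h1 : 0 < j - i := by
      by_contra hc
      nlinarith
    nlinarith
  all_goals
    first
    | (have := far i hi; omega)
    | (have := far j hj; omega)
    | omega

/-- The maximal `e`-blocks of size at least two of a set in which exactly `m - e` and `m`
have a successor. -/
lemma maximal_block_iff_of_filter {n : ℕ} {T : Finset (ZMod n)} {m : ZMod n} {D : ℕ}
    (hT : T.filter (fun x => x + (D : ZMod n) ∈ T) = {m - (D : ZMod n), m})
    (h1 : (D : ZMod n) ≠ 0) (h2 : (D : ZMod n) + D ≠ 0) (B : Finset (ZMod n)) :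
    (∃ b : ZMod n, ∃ s : ℕ, 2 ≤ s ∧
        B = (Finset.range s).image (fun i => b + ((i * D : ℕ) : ZMod n)) ∧
        B ⊆ T ∧ b - (D : ZMod n) ∉ T ∧ b + ((s * D : ℕ) : ZMod n) ∉ T)
      ↔ B = {m - (D : ZMod n), m, m + (D : ZMod n)} := by
  set e : ZMod n := (D : ZMod n) with he
  have key : ∀ x, (x ∈ T ∧ x + e ∈ T) ↔ x = m - e ∨ x = m := by
    intro x
    simpa using Finset.ext_iff.1 hT x
  have hm : m ∈ T ∧ m + e ∈ T := (key m).2 (Or.inr rfl)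
  have hme : m - e ∈ T := ((key (m - e)).2 (Or.inl rfl)).1
  have hafter : m + e + e ∉ T := fun h => by
    rcases (key (m + e)).1 ⟨hm.2, h⟩ with h | h
    · exact h2 (by linear_combination h)
    · exact h1 (by linear_combination h)
  have hbefore : m - e - e ∉ T := fun h => by
    rcases (key (m - e - e)).1 ⟨h, by simpa using hme⟩ with h | h
    · exact h1 (by linear_combination -h)
    · exact h2 (by linear_combination -h)
  have himage : (Finset.range 3).image (fun i => m - e + ((i * D : ℕ) : ZMod n)) =
      {m - e, m, m + e} := by
    have hr : Finset.range 3 = {0, 1, 2} := rfl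
    have hadd : m - e + 2 * e = m + e := by ring
    simp [hr, Finset.image_insert, ← he, hadd]
  constructor
  · rintro ⟨b, s, hs, rfl, hsub, hb, hend⟩
    have hmem : ∀ i < s, b + (i : ZMod n) * e ∈ T := fun i hi => by
      have := hsub (Finset.mem_image_of_mem _ (Finset.mem_range.2 hi))
      simpa using this
    have hb0 : b ∈ T := by simpa using hmem 0 (by omega)
    have hb1 : b + e ∈ T := by simpa using hmem 1 (by omega)
    rcases (key b).1 ⟨hb0, hb1⟩ with rfl | rfl
    · have hs3 : s = 3 := by
        by_contra hne
        rcases (by omega : s = 2 ∨ 3 < s) with rfl | h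
        · refine hend ?_
          convert hm.2 using 1
          push_cast
          ring
        · refine hafter ?_
          convert hmem 3 h using 1
          push_cast
          ring
      rw [hs3, himage]
    · exact absurd hme hb
  · rintro rfl
    refine ⟨m - e, 3, by norm_num, himage.symm, ?_, hbefore, ?_⟩
    · intro x hx
      simp only [Finset.mem_insert, Finset.mem_singleton] at hx
      rcases hx with rfl | rfl | rfl
      exacts [hme, hm.1, hm.2]
    · convert hafter using 2
      push_cast
      ring

/-- The moved configuration described by integer offsets from the middle robot. -/
lemma mem_moved_block_iff {n d h : ℕ} (hd : 2 ≤ d) (hh : 1 ≤ h) (hn : (2 * h + 1) * d ≤ n)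
    (a x : ZMod n) :
    x ∈ ((Finset.range (2 * h + 1)).image (fun i => a + ((i * d : ℕ) : ZMod n)) \
        {a + ((h * d : ℕ) : ZMod n) - (d : ZMod n), a + ((h * d : ℕ) : ZMod n) + (d : ZMod n)}) ∪
        {a + ((h * d : ℕ) : ZMod n) - ((d - 1 : ℕ) : ZMod n),
          a + ((h * d : ℕ) : ZMod n) + ((d - 1 : ℕ) : ZMod n)} ↔
      ∃ p : ℤ, IsMovedOffset d h p ∧ x = a + ((h * d : ℕ) : ZMod n) + (p : ZMod n) := by
  have hn' : (2 * (h : ℤ) + 1) * d ≤ n := by exact_mod_cast hn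
  have hd' : (2 : ℤ) ≤ d := by exact_mod_cast hd
  have hh' : (1 : ℤ) ≤ h := by exact_mod_cast hh
  have hcast : ((d - 1 : ℕ) : ZMod n) = (((d : ℤ) - 1 : ℤ) : ZMod n) := by
    rw [Nat.cast_sub (by omega)]
    push_cast
    rfl
  rw [hcast]
  simp only [Finset.mem_union, Finset.mem_sdiff, Finset.mem_image, Finset.mem_range,
    Finset.mem_insert, Finset.mem_singleton, not_or]
  constructor
  · rintro (⟨⟨i, hi, rfl⟩, h1, h2⟩ | rfl | rfl)
    · by_cases h0 : i = h
      · exact ⟨0, Or.inl rfl, by simp [h0]⟩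
      · refine ⟨((i : ℤ) - h) * d, Or.inr (Or.inr (Or.inr ⟨(i : ℤ) - h, ?_, ?_, rfl⟩)), ?_⟩
        · have h1' : (i : ℤ) - h ≠ -1 := fun hc => h1 (by
            have : (i : ZMod n) - h = -1 := by exact_mod_cast congrArg (Int.cast : ℤ → ZMod n) hc
            push_cast
            linear_combination (d : ZMod n) * this)
          have h2' : (i : ℤ) - h ≠ 1 := fun hc => h2 (by
            have : (i : ZMod n) - h = 1 := by exact_mod_cast congrArg (Int.cast : ℤ → ZMod n) hc
            push_cast
            linear_combination (d : ZMod n) * this)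
          rw [le_abs]
          omega
        · rw [abs_le]
          omega
        · push_cast
          ring
    · exact ⟨-((d : ℤ) - 1), Or.inr (Or.inr (Or.inl rfl)), by push_cast; ring⟩
    · exact ⟨(d : ℤ) - 1, Or.inr (Or.inl rfl), rfl⟩
  · have hS : ∀ j : ℤ, |j| ≤ h → j ≠ -1 → j ≠ 1 →
        (∃ i < 2 * h + 1, a + ((i * d : ℕ) : ZMod n) =
          a + ((h * d : ℕ) : ZMod n) + ((j * d : ℤ) : ZMod n)) ∧
        ¬ a + ((h * d : ℕ) : ZMod n) + ((j * d : ℤ) : ZMod n) =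
          a + ((h * d : ℕ) : ZMod n) - (d : ZMod n) ∧
        ¬ a + ((h * d : ℕ) : ZMod n) + ((j * d : ℤ) : ZMod n) =
          a + ((h * d : ℕ) : ZMod n) + (d : ZMod n) := by
      intro j hj hj1 hj2
      rw [abs_le] at hj
      refine ⟨⟨(h + j).toNat, by omega, ?_⟩, fun hc => hj1 ?_, fun hc => hj2 ?_⟩
      · have : (((h + j).toNat : ℤ) : ZMod n) = ((h + j : ℤ) : ZMod n) := by
          rw [Int.toNat_of_nonneg (by omega)]
        push_cast at this ⊢
        rw [this]
        ring
      · have hz : ((j * d : ℤ) : ZMod n) = ((-d : ℤ) : ZMod n) := by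
          push_cast at hc ⊢
          linear_combination hc
        have := intCast_zmod_eq_of_abs_sub_lt hz (by rw [abs_lt]; constructor <;> nlinarith)
        nlinarith
      · have hz : ((j * d : ℤ) : ZMod n) = ((d : ℤ) : ZMod n) := by
          push_cast at hc ⊢
          linear_combination hc
        have := intCast_zmod_eq_of_abs_sub_lt hz (by rw [abs_lt]; constructor <;> nlinarith)
        nlinarith
    rintro ⟨p, rfl | rfl | rfl | ⟨j, hj2, hj, rfl⟩, rfl⟩
    · left
      have := hS 0 (by simp) (by norm_num) (by norm_num)
      rwa [zero_mul] at this
    · exact Or.inr (Or.inr rfl)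
    · right; left
      push_cast
      ring
    · left
      refine hS j hj ?_ ?_ <;> rintro rfl <;> norm_num at hj2


/-- When the two robots adjacent to the middle robot of a single `d`.block of odd size
`k ≥ 3` each move one node toward it, the resulting configuration has inter-distance
`d - 1` and contains exactly one maximal `(d-1)`.block, namely the three central
robots. -/
theorem middle_move_creates_unique_block (n d k : ℕ) (hd : 2 ≤ d) (hk : Odd k)
    (hk3 : 3 ≤ k) (hn : k * d ≤ n) (a : ZMod n) :
    let S : Finset (ZMod n) := (Finset.range k).image (fun i => a + ((i * d : ℕ) : ZMod n))
    let m : ZMod n := a + (((k - 1) / 2 * d : ℕ) : ZMod n)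
    let e : ZMod n := ((d - 1 : ℕ) : ZMod n)
    let S' : Finset (ZMod n) := (S \ {m - (d : ZMod n), m + (d : ZMod n)}) ∪ {m - e, m + e}
    -- (i) the inter-distance of `S'` equals `d - 1`
    (IsLeast {t : ℕ | ∃ x ∈ S', ∃ y ∈ S', x ≠ y ∧ t = min (x - y).val (y - x).val} (d - 1)) ∧
    -- (ii) the robots having another robot at distance `d - 1` ahead are exactly `m - e` and `m`
    (S'.filter (fun x => x + e ∈ S') = {m - e, m}) ∧
    -- consequently there is exactly one maximal `(d-1)`.block, namely `{m - e, m, m + e}`, of size 3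
    (∀ B : Finset (ZMod n),
      (∃ b : ZMod n, ∃ s : ℕ, 2 ≤ s ∧
        B = (Finset.range s).image (fun i => b + ((i * (d - 1) : ℕ) : ZMod n)) ∧
        B ⊆ S' ∧ b - e ∉ S' ∧ b + ((s * (d - 1) : ℕ) : ZMod n) ∉ S')
      ↔ B = {m - e, m, m + e}) := by
  obtain ⟨h, rfl⟩ := hk
  have hh : 1 ≤ h := by omega
  rw [show (2 * h + 1 - 1) / 2 = h by omega]
  intro S m e S'
  have hn' : (2 * (h : ℤ) + 1) * d ≤ n := by exact_mod_cast hn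
  have hd' : (2 : ℤ) ≤ d := by exact_mod_cast hd
  have hh' : (1 : ℤ) ≤ h := by exact_mod_cast hh
  have hdn : 3 * (d : ℤ) ≤ n := by nlinarith
  have : NeZero n := ⟨by omega⟩
  have hmem : ∀ x, x ∈ S' ↔ ∃ p : ℤ, IsMovedOffset d h p ∧ x = m + (p : ZMod n) :=
    mem_moved_block_iff hd hh hn a
  have hcast : e = (((d : ℤ) - 1 : ℤ) : ZMod n) := by
    simp only [e]
    rw [Nat.cast_sub (by omega)]
    push_cast
    rfl
  have he1 : e ≠ 0 := fun hc => by
    have := intCast_zmod_eq_of_abs_sub_lt (b := 0) (by rw [← hcast, hc, Int.cast_zero])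
      (by rw [abs_lt]; omega)
    omega
  have he2 : e + e ≠ 0 := fun hc => by
    have := intCast_zmod_eq_of_abs_sub_lt (n := n) (a := (d - 1) + (d - 1 : ℤ)) (b := 0)
      (by rw [Int.cast_add, ← hcast, hc, Int.cast_zero]) (by rw [abs_lt]; omega)
    omega
  have hm : m ∈ S' := (hmem m).2 ⟨0, Or.inl rfl, by simp⟩
  have hme : m + e ∈ S' := (hmem _).2 ⟨_, Or.inr (Or.inl rfl), by rw [hcast]⟩
  have hme' : m - e ∈ S' :=
    (hmem _).2 ⟨_, Or.inr (Or.inr (Or.inl rfl)), by rw [Int.cast_neg, ← hcast, sub_eq_add_neg]⟩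
  -- a robot with another one at distance `c ≤ d - 1` ahead
  have hgap : ∀ x ∈ S', ∀ c : ℕ, 0 < c → c ≤ d - 1 → x + (c : ZMod n) ∈ S' →
      c = d - 1 ∧ (x = m - e ∨ x = m) := by
    intro x hx c hc0 hc hxc
    obtain ⟨p, hp, rfl⟩ := (hmem x).1 hx
    obtain ⟨q, hq, hqx⟩ := (hmem _).1 hxc
    have hpb := abs_le.1 (hp.abs_le hd' hh')
    have hqb := abs_le.1 (hq.abs_le hd' hh')
    have hqp : q = p + c := by
      refine intCast_zmod_eq_of_abs_sub_lt (n := n) ?_ ?_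
      · push_cast
        linear_combination -hqx
      · rw [add_mul, mul_assoc] at hn'
        rw [abs_lt]
        omega
    obtain ⟨h1, h2⟩ := hp.eq_of_sub_le hd' hq (by omega) (by omega)
    refine ⟨by omega, h2.imp ?_ ?_⟩
    · rintro rfl
      rw [Int.cast_neg, ← hcast, sub_eq_add_neg]
    · rintro rfl
      simp
  have hval : ∀ x ∈ S', ∀ y ∈ S', x ≠ y → d - 1 ≤ (x - y).val := by
    intro x hx y hy hxy
    by_contra! hlt
    have hpos : 0 < (x - y).val :=
      Nat.pos_of_ne_zero fun h0 => hxy (sub_eq_zero.1 ((ZMod.val_eq_zero _).1 h0))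
    have := (hgap y hy _ hpos hlt.le (by simpa using hx)).1
    omega
  have hfilter : S'.filter (fun x => x + e ∈ S') = {m - e, m} := by
    ext x
    simp only [Finset.mem_filter, Finset.mem_insert, Finset.mem_singleton]
    constructor
    · rintro ⟨hx, hxe⟩
      exact (hgap x hx (d - 1) (by omega) le_rfl hxe).2
    · rintro (rfl | rfl)
      · exact ⟨hme', by simpa using hm⟩
      · exact ⟨hm, hme⟩
  refine ⟨⟨⟨m + e, hme, m, hm, by simpa using he1, ?_⟩, ?_⟩, hfilter,
    maximal_block_iff_of_filter hfilter he1 he2⟩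
  · have hve : (m + e - m).val = d - 1 := by
      rw [add_sub_cancel_left]
      exact ZMod.val_natCast_of_lt (by omega)
    rw [hve, min_eq_left (hval m hm (m + e) hme (by simpa using he1))]
  · rintro t ⟨x, hx, y, hy, hxy, rfl⟩
    exact le_min (hval x hx y hy hxy) (hval y hy x hx hxy.symm)
end

section
/- Let n ≥ 1 and let S be a nonempty finite subset of ZMod n. For x ∈ S, let gap(x) be the least t with 1 ≤ t ≤ n such that x + t ∈ S (the distance from x to the next occupied node in a fixed direction around the ring). If there exists a unique x₀ ∈ S at which gap attains its maximum over S, then S is not periodic: there is no r ≠ 0 in ZMod n with S + r = S. -/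
/-- If the gap function (distance to the next occupied node in a fixed direction)
attains its maximum over `S` at a unique robot, then `S` is not periodic. -/
theorem unique_max_gap_not_periodic (n : ℕ) (hn : 1 ≤ n) (S : Finset (ZMod n))
    (hS : S.Nonempty) :
    let gap : ZMod n → ℕ := fun x => sInf {t : ℕ | 1 ≤ t ∧ t ≤ n ∧ x + (t : ZMod n) ∈ S}
    (∃! x₀, x₀ ∈ S ∧ ∀ x ∈ S, gap x ≤ gap x₀) →
    ¬ ∃ r : ZMod n, r ≠ 0 ∧ S.image (fun x => x + r) = S := by
  rintro gap ⟨x₀, ⟨hx₀, hmax⟩, huniq⟩ ⟨r, hr, hSr⟩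
  have mem_add_iff (y : ZMod n) : y + r ∈ S ↔ y ∈ S := by
    conv_lhs => rw [← hSr]
    simp
  have gap_add (x : ZMod n) : gap (x + r) = gap x := by
    simp only [gap, add_right_comm x r, mem_add_iff]
  have h : x₀ + r = x₀ :=
    huniq _ ⟨(mem_add_iff x₀).2 hx₀, fun x hx => (gap_add x₀).symm ▸ hmax x hx⟩
  exact hr (add_eq_left.1 h)
end
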